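/- For every n ≥ 9, a cop-win graph G on n vertices satisfies cr(G) − r(G) = n − 4 (where r(G) = 1 if G is tp1 and r(G) = 0 if G is tp0; equivalently, G has capture time n − 4, i.e. G is CT-maximal) if and only if the rank cardinality vector of G is (2, 2, 2, 1, 1, ..., 1) of length n − 3 (three leading entries 2 followed by n − 6 entries 1); moreover any such G is tp1. -/

import Mathlib

namespace CopsRobbers

variable {V : Type*}

/-- The closed neighborhood of `v` within the vertex set `S` (graphs are reflexive,
so `v` itself belongs to its closed neighborhood). -/
def closedNbhd (G : SimpleGraph V) (S : Set V) (v : V) : Set V :=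
  {u | u ∈ S ∧ (u = v ∨ G.Adj u v)}

/-- `v` is a strict corner of the subgraph induced on `S`: some other vertex `w ∈ S`
strictly corners `v`, i.e. `N[v] ⊊ N[w]` within `S`. -/
def StrictCorner (G : SimpleGraph V) (S : Set V) (v : V) : Prop :=
  v ∈ S ∧ ∃ w ∈ S, w ≠ v ∧ closedNbhd G S v ⊂ closedNbhd G S w

/-- The remaining vertex sets of the corner ranking procedure (0-indexed auxiliary
version): at each step all current strict corners are removed. -/
def stageAux (G : SimpleGraph V) : ℕ → Set V
  | 0 => Set.univ
  | n + 1 => stageAux G n \ {v | StrictCorner G (stageAux G n) v}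

/-- `stage G k` is the vertex set of `G^(k)` (for `k ≥ 1`), so `stage G 1 = V(G)`. -/
def stage (G : SimpleGraph V) (k : ℕ) : Set V := stageAux G (k - 1)

/-- The corner rank of a vertex: the least `k ≥ 1` such that `v` is a strict corner
of `G^(k)`, or `G^(k)` is a clique still containing `v`; and `⊤` (that is, `∞`) if
there is no such `k`. -/
noncomputable def cornerRank (G : SimpleGraph V) (v : V) : ℕ∞ :=
  sInf {k : ℕ∞ | ∃ n : ℕ, k = (n : ℕ∞) ∧ 1 ≤ n ∧
    (StrictCorner G (stage G n) v ∨ (G.IsClique (stage G n) ∧ v ∈ stage G n))}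

/-- The corner rank of a graph: the largest corner rank of a vertex. -/
noncomputable def graphRank (G : SimpleGraph V) : ℕ∞ := ⨆ v, cornerRank G v

/-- A graph is cop-win iff every vertex has finite corner rank. -/
def CopWin (G : SimpleGraph V) : Prop := ∀ v, cornerRank G v ≠ ⊤

/-- `v` dominates the set `S`: `v` is (reflexively) adjacent to every vertex of `S`. -/
def Dominates (G : SimpleGraph V) (v : V) (S : Set V) : Prop :=
  ∀ u ∈ S, u = v ∨ G.Adj v u

/-- A cop-win graph of corner rank `α ≥ 2` is `tp1` if some vertex of corner rank `α`
dominates the vertex set of `G^(α-1)`. -/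
def Tp1 (G : SimpleGraph V) : Prop :=
  ∃ α : ℕ, 2 ≤ α ∧ graphRank G = (α : ℕ∞) ∧
    ∃ v, cornerRank G v = (α : ℕ∞) ∧ Dominates G v (stage G (α - 1))

/-- `G` realizes the vector `(x_α, …, x_1)` (written as the list `[x_α, …, x_1]`):
`G` is cop-win of corner rank `α` and for each `k`, `x_k` is the number of vertices
of corner rank `k`. -/
def Realizes (G : SimpleGraph V) (x : List ℕ) : Prop :=
  CopWin G ∧ graphRank G = (x.length : ℕ∞) ∧
  ∀ i : Fin x.length,
    x.get i = {v | cornerRank G v = ((x.length - (i : ℕ) : ℕ) : ℕ∞)}.ncard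

/-- `G` r-realizes `x` (for `r ∈ {0,1}`): `G` realizes `x` and `G` is tp-r. -/
def RRealizes (G : SimpleGraph V) (r : ℕ) (x : List ℕ) : Prop :=
  Realizes G x ∧ (Tp1 G ↔ r = 1)

/-- A vector is realizable if it is the rank cardinality vector of some finite cop-win graph. -/
def Realizable (x : List ℕ) : Prop :=
  ∃ (W : Type) (_ : Fintype W) (G : SimpleGraph W), Realizes G x

/-- A vector is r-realizable if some finite tp-r cop-win graph realizes it. -/
def RRealizable (r : ℕ) (x : List ℕ) : Prop :=
  ∃ (W : Type) (_ : Fintype W) (G : SimpleGraph W), RRealizes G r x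

open Classical in
/-- The capture time of a cop-win graph: `cr(G) - r(G)`. -/
noncomputable def captureTime (G : SimpleGraph V) : ℕ :=
  (graphRank G).toNat - (if Tp1 G then 1 else 0)

end CopsRobbers

namespace CopsRobbers

variable {V : Type*}

/-- Reflexive adjacency. -/
def ReflAdj (G : SimpleGraph V) (u v : V) : Prop := u = v ∨ G.Adj u v

/-- The vertices removed at a given stage of the corner ranking procedure. -/
def level (G : SimpleGraph V) (k : ℕ) : Set V := stageAux G k \ stageAux G (k + 1)

variable {G : SimpleGraph V} {k m M : ℕ} {u v w : V}

/-- `w` strictly corners `v` in the stage-`k` subgraph. -/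
def Corners (G : SimpleGraph V) (k : ℕ) (v w : V) : Prop :=
  (∀ u ∈ stageAux G k, ReflAdj G u v → ReflAdj G u w) ∧
    ∃ u ∈ stageAux G k, ReflAdj G u w ∧ ¬ ReflAdj G u v

lemma ReflAdj.refl (G : SimpleGraph V) (v : V) : ReflAdj G v v := Or.inl rfl

lemma ReflAdj.symm (h : ReflAdj G u v) : ReflAdj G v u :=
  h.imp Eq.symm SimpleGraph.Adj.symm

lemma closedNbhd_subset_iff {S : Set V} :
    closedNbhd G S v ⊆ closedNbhd G S w ↔ ∀ u ∈ S, ReflAdj G u v → ReflAdj G u w :=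
  ⟨fun h _ hu huv => (h ⟨hu, huv⟩).2, fun h u hu => ⟨hu.1, h u hu.1 hu.2⟩⟩

lemma stageAux_succ_subset (G : SimpleGraph V) (k : ℕ) : stageAux G (k + 1) ⊆ stageAux G k :=
  Set.sdiff_subset

lemma stageAux_antitone (G : SimpleGraph V) : Antitone (stageAux G) :=
  antitone_nat_of_succ_le (stageAux_succ_subset G)

lemma strictCorner_of_mem_level (hv : v ∈ level G k) : StrictCorner G (stageAux G k) v := by
  by_contra h
  exact hv.2 ⟨hv.1, h⟩

lemma notMem_stageAux_succ_of_strictCorner (hv : StrictCorner G (stageAux G k) v) :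
    v ∉ stageAux G (k + 1) := fun h => h.2 hv

lemma exists_cornering_of_mem_level [Finite V] (hv : v ∈ level G k) :
    ∃ w ∈ stageAux G (k + 1), Corners G k v w := by
  obtain ⟨-, w₀, hw₀, -, hlt₀⟩ := strictCorner_of_mem_level hv
  obtain ⟨w, ⟨hw, hlt⟩, hmax⟩ := Set.Finite.exists_maximalFor (closedNbhd G (stageAux G k))
    {w | w ∈ stageAux G k ∧ closedNbhd G (stageAux G k) v ⊂ closedNbhd G (stageAux G k) w}
    (Set.toFinite _) ⟨w₀, hw₀, hlt₀⟩
  refine ⟨w, ⟨hw, ?_⟩, closedNbhd_subset_iff.1 hlt.1, ?_⟩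
  · rintro ⟨-, x, hx, -, hwx⟩
    exact hwx.2 (hmax ⟨hx, hlt.trans hwx⟩ hwx.1)
  · have := hlt.2
    rw [closedNbhd_subset_iff] at this
    push Not at this
    exact this

lemma reflAdj_of_closedNbhd_subset (hv : v ∈ stageAux G (k + 1)) (hw : w ∈ stageAux G k)
    (h : ∀ u ∈ stageAux G k, ReflAdj G u v → ReflAdj G u w)
    (hu : u ∈ stageAux G k) (huw : ReflAdj G u w) : ReflAdj G u v := by
  by_contra huv
  refine hv.2 ⟨hv.1, w, hw, ?_, closedNbhd_subset_iff.2 h, ?_⟩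
  · rintro rfl
    exact huv huw
  · rw [closedNbhd_subset_iff]
    exact fun h' => huv (h' u hu huw)

/-- If `w` strictly corners `v` at stage `k + 1`, then some vertex removed just before is a
neighbor of `v` but not of `w`. -/
lemma exists_mem_level_not_reflAdj (hv : v ∈ stageAux G (k + 1)) (hw : w ∈ stageAux G (k + 1))
    (h : Corners G (k + 1) v w) :
    ∃ y ∈ level G k, ReflAdj G y v ∧ ¬ ReflAdj G y w := by
  by_contra! hc
  obtain ⟨h, u, hu, huw, huv⟩ := h
  refine huv (reflAdj_of_closedNbhd_subset hv (stageAux_succ_subset G k hw) ?_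
    (stageAux_succ_subset G k hu) huw)
  intro x hx hxv
  by_cases hx' : x ∈ stageAux G (k + 1)
  · exact h x hx' hxv
  · exact hc x ⟨hx, hx'⟩ hxv

/-- If only one vertex is removed at stage `k`, then that vertex is adjacent to all vertices
removed at stage `k + 1`, and so is the vertex cornering it. -/
lemma exists_dominating_of_ncard_level_eq_one [Finite V] (h : (level G k).ncard = 1) :
    ∃ p ∈ stageAux G (k + 1), ∀ x ∈ level G (k + 1), ReflAdj G x p := by
  obtain ⟨y, hy⟩ := Set.ncard_eq_one.1 h
  have hyl : y ∈ level G k := by simp [hy]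
  obtain ⟨p, hp, hyp, -⟩ := exists_cornering_of_mem_level hyl
  refine ⟨p, hp, fun x hx => hyp x (stageAux_succ_subset G k hx.1) ?_⟩
  obtain ⟨w, hw, hxw⟩ := exists_cornering_of_mem_level hx
  obtain ⟨z, hz, hzx, -⟩ := exists_mem_level_not_reflAdj hx.1
    (stageAux_succ_subset G _ hw) hxw
  rw [hy, Set.mem_singleton_iff] at hz
  exact hz ▸ hzx.symm

lemma exists_dominating_of_ncard_level_eq_one' [Finite V] (h : (level G k).ncard = 1) :
    ∃ p ∈ stageAux G (k + 2), ∀ x ∈ level G (k + 1), ReflAdj G x p := by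
  obtain ⟨p, hp, hpx⟩ := exists_dominating_of_ncard_level_eq_one h
  by_cases hp' : p ∈ stageAux G (k + 2)
  · exact ⟨p, hp', hpx⟩
  · obtain ⟨w, hw, hpw, -⟩ := exists_cornering_of_mem_level (k := k + 1) ⟨hp, hp'⟩
    exact ⟨w, hw, fun x hx => hpw x hx.1 (hpx x hx)⟩

/-- The vertices removed at stage `k` are `u₁` and `u₂`; they are nonadjacent, and have no
neighbors in the stage-`k` subgraph other than `w₁` and `w₂`, respectively. -/
structure PendantPair (G : SimpleGraph V) (k : ℕ) (u₁ u₂ w₁ w₂ : V) : Prop where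
  level_eq : level G k = {u₁, u₂}
  ne : u₁ ≠ u₂
  ne_right : u₁ ≠ w₂
  ne_left : u₂ ≠ w₁
  nbhd_left : ∀ x ∈ stageAux G k, ReflAdj G x u₁ → x = u₁ ∨ x = w₁
  nbhd_right : ∀ x ∈ stageAux G k, ReflAdj G x u₂ → x = u₂ ∨ x = w₂

lemma PendantPair.ncard_level_ne_one [Finite V] {u₁ u₂ w₁ w₂ : V}
    (h : PendantPair G (k + 1) u₁ u₂ w₁ w₂) (hw : w₁ ≠ w₂) : (level G k).ncard ≠ 1 := by
  intro h1
  obtain ⟨p, hp, hpx⟩ := exists_dominating_of_ncard_level_eq_one h1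
  obtain ⟨hl, h₁, h₂, h₃, hu₁, hu₂⟩ := h
  have e₁ := hu₁ p hp (hpx u₁ (by simp [hl])).symm
  have e₂ := hu₂ p hp (hpx u₂ (by simp [hl])).symm
  grind

/-- A pendant vertex removed at stage `k + 1` has a neighbor removed at stage `k`, which it
corners. -/
lemma exists_cornered_of_pendant [Finite V] (hu : u ∈ level G (k + 1))
    (hN : ∀ x ∈ stageAux G (k + 1), ReflAdj G x u → x = u ∨ x = w) :
    ∃ d ∈ level G k, ReflAdj G d u ∧ ¬ ReflAdj G d w ∧
      ∀ x ∈ stageAux G k, ReflAdj G x d → ReflAdj G x u := by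
  obtain ⟨z, hz, huz⟩ := exists_cornering_of_mem_level hu
  have hzu : z ≠ u := by
    rintro rfl
    exact hu.2 hz
  obtain rfl := (hN z (stageAux_succ_subset G _ hz) (huz.1 u hu.1 (.refl G u)).symm).resolve_left hzu
  obtain ⟨d, hd, hdu, hdz⟩ := exists_mem_level_not_reflAdj hu.1 (stageAux_succ_subset G _ hz) huz
  refine ⟨d, hd, hdu, hdz, ?_⟩
  obtain ⟨s, hsm, hds, -⟩ := exists_cornering_of_mem_level hd
  have hsd : ReflAdj G d s := hds d hd.1 (.refl G d)
  obtain rfl | rfl := hN s hsm (hds u (stageAux_succ_subset G _ hu.1) hdu.symm).symm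
  · exact hds
  · exact absurd hsd hdz

lemma PendantPair.of_succ [Finite V] {u₁ u₂ w₁ w₂ : V}
    (h : PendantPair G (k + 1) u₁ u₂ w₁ w₂) (h2 : (level G k).ncard ≤ 2) :
    ∃ d₁ d₂, PendantPair G k d₁ d₂ u₁ u₂ := by
  obtain ⟨hl, h₁, h₂, h₃, hu₁, hu₂⟩ := h
  have m₁ : u₁ ∈ level G (k + 1) := by simp [hl]
  have m₂ : u₂ ∈ level G (k + 1) := by simp [hl]
  obtain ⟨d₁, hd₁, a₁, b₁, c₁⟩ := exists_cornered_of_pendant m₁ hu₁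
  obtain ⟨d₂, hd₂, a₂, b₂, c₂⟩ := exists_cornered_of_pendant m₂ hu₂
  have hu₁₂ : ¬ ReflAdj G u₁ u₂ := fun h => by
    have := hu₂ u₁ m₁.1 h
    grind
  have n₁ : ¬ ReflAdj G u₂ d₁ := fun h =>
    hu₁₂ (c₁ u₂ (stageAux_succ_subset G _ m₂.1) h).symm
  have n₂ : ¬ ReflAdj G u₁ d₂ := fun h => hu₁₂ (c₂ u₁ (stageAux_succ_subset G _ m₁.1) h)
  have hne : d₁ ≠ d₂ := by
    rintro rfl
    exact n₁ a₂.symm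
  have hl' : level G k = {d₁, d₂} := by
    refine (Set.eq_of_subset_of_ncard_le ?_ ?_ (Set.toFinite _)).symm
    · rintro x (rfl | rfl)
      exacts [hd₁, hd₂]
    · rwa [Set.ncard_pair hne]
  have hlev : ∀ x ∈ stageAux G k, x ∈ stageAux G (k + 1) ∨ x = d₁ ∨ x = d₂ := by
    intro x hx
    by_cases hx' : x ∈ stageAux G (k + 1)
    · exact Or.inl hx'
    · have : x ∈ level G k := ⟨hx, hx'⟩
      rw [hl'] at this
      exact Or.inr this
  refine ⟨d₁, d₂, hl', hne, ?_, ?_, ?_, ?_⟩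
  · rintro rfl
    exact hd₁.2 m₂.1
  · rintro rfl
    exact hd₂.2 m₁.1
  · intro x hx hxd
    rcases hlev x hx with h | rfl | rfl
    · obtain rfl | rfl := hu₁ x h (c₁ x hx hxd)
      · exact Or.inr rfl
      · exact absurd hxd.symm b₁
    · exact Or.inl rfl
    · exact absurd (c₁ x hx hxd).symm n₂
  · intro x hx hxd
    rcases hlev x hx with h | rfl | rfl
    · obtain rfl | rfl := hu₂ x h (c₂ x hx hxd)
      · exact Or.inr rfl
      · exact absurd hxd.symm b₂
    · exact absurd (c₂ x hx hxd).symm n₁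
    · exact Or.inl rfl

lemma mem_or_mem_level (hv : v ∈ stageAux G k) : v ∈ stageAux G (k + 1) ∨ v ∈ level G k := by
  by_cases h : v ∈ stageAux G (k + 1)
  · exact Or.inl h
  · exact Or.inr ⟨hv, h⟩

lemma four_le_ncard [Finite V] {s : Set V} {a b c d : V} (ha : a ∈ s) (hb : b ∈ s) (hc : c ∈ s)
    (hd : d ∈ s) (hab : a ≠ b) (hac : a ≠ c) (had : a ≠ d) (hbc : b ≠ c) (hbd : b ≠ d)
    (hcd : c ≠ d) : 4 ≤ s.ncard := by
  classical
  have : ((({a, b, c, d} : Finset V) : Set V)).ncard ≤ s.ncard := by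
    refine Set.ncard_le_ncard ?_ (Set.toFinite _)
    intro x
    simp only [Finset.coe_insert, Finset.coe_singleton, Set.mem_insert_iff, Set.mem_singleton_iff]
    rintro (rfl | rfl | rfl | rfl) <;> assumption
  rw [Set.ncard_coe_finset] at this
  simpa [hab, hac, had, hbc, hbd, hcd] using this

lemma two_le_ncard [Finite V] {s : Set V} {a b : V} (ha : a ∈ s) (hb : b ∈ s) (hab : a ≠ b) :
    2 ≤ s.ncard :=
  (Set.one_lt_ncard_iff (Set.toFinite _)).2 ⟨a, b, ha, hb, hab⟩

section Dominated

variable [Finite V]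

lemma exists_not_reflAdj_of_dominated
    (hdom : ∀ a ∈ stageAux G (m + 1), ∀ u ∈ stageAux G m, ReflAdj G u a)
    {b : V} (hb : b ∈ level G m) : ∃ b' ∈ level G m, ¬ ReflAdj G b' b := by
  obtain ⟨a, ha, -, u, hu, hua, hub⟩ := exists_cornering_of_mem_level hb
  exact ⟨u, ⟨hu, fun hu' => hub (hdom u hu' b hb.1).symm⟩, hub⟩

lemma corners_of_dominated
    (hdom : ∀ a ∈ stageAux G (m + 1), ∀ u ∈ stageAux G m, ReflAdj G u a)
    {a b : V} (ha : a ∈ stageAux G (m + 1)) (hb : b ∈ level G m) : Corners G m b a := by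
  obtain ⟨b', hb', h⟩ := exists_not_reflAdj_of_dominated hdom hb
  exact ⟨fun u hu _ => hdom a ha u hu, b', hb'.1, hdom a ha b' hb'.1, h⟩

lemma two_le_ncard_level_of_dominated
    (hdom : ∀ a ∈ stageAux G (m + 1), ∀ u ∈ stageAux G m, ReflAdj G u a)
    (hB : (level G m).Nonempty) : 2 ≤ (level G m).ncard := by
  obtain ⟨b, hb⟩ := hB
  obtain ⟨b', hb', h⟩ := exists_not_reflAdj_of_dominated hdom hb
  refine two_le_ncard hb hb' ?_
  rintro rfl
  exact h (.refl G b)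

lemma ncard_level_ne_one_of_dominated
    (hdom : ∀ a ∈ stageAux G (m + 2), ∀ u ∈ stageAux G (m + 1), ReflAdj G u a)
    (hA : (stageAux G (m + 2)).Nonempty) (hB : (level G (m + 1)).Nonempty) :
    (level G m).ncard ≠ 1 := by
  intro h
  obtain ⟨c, hc⟩ := Set.ncard_eq_one.1 h
  have hcl : c ∈ level G m := by simp [hc]
  have key : ∀ a ∈ stageAux G (m + 2), ∀ b ∈ level G (m + 1),
      ReflAdj G c b ∧ ¬ ReflAdj G c a := by
    intro a ha b hb
    obtain ⟨y, hy, h1, h2⟩ := exists_mem_level_not_reflAdj hb.1 (stageAux_succ_subset G _ ha)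
      (corners_of_dominated hdom ha hb)
    rw [hc, Set.mem_singleton_iff] at hy
    exact hy ▸ ⟨h1, h2⟩
  obtain ⟨a, ha⟩ := hA
  obtain ⟨b, hb⟩ := hB
  obtain ⟨s, hs, hcs, -⟩ := exists_cornering_of_mem_level hcl
  rcases mem_or_mem_level hs with hs | hs
  · exact (key s hs b hb).2 (hcs c hcl.1 (.refl G c))
  · obtain ⟨b', hb', h'⟩ := exists_not_reflAdj_of_dominated hdom hs
    exact h' (hcs b' (stageAux_succ_subset G _ hb'.1) (key a ha b' hb').1.symm)

/-- If a unique vertex of maximal rank dominates its surroundings and a single vertex is removed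
at stage `m`, then at least four vertices are removed at stage `m + 2`. -/
lemma four_le_ncard_level_of_dominated {a : V} (hA : stageAux G (m + 3) = {a})
    (hdom : ∀ a ∈ stageAux G (m + 3), ∀ u ∈ stageAux G (m + 2), ReflAdj G u a)
    (hB : (level G (m + 2)).Nonempty) (hD : (level G m).ncard = 1) :
    4 ≤ (level G (m + 2)).ncard := by
  have haA : a ∈ stageAux G (m + 3) := by simp [hA]
  have key : ∀ b ∈ level G (m + 2), ∃ c ∈ level G (m + 1), ReflAdj G c b ∧ ¬ ReflAdj G c a :=
    fun b hb => exists_mem_level_not_reflAdj hb.1 (stageAux_succ_subset G _ haA)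
      (corners_of_dominated hdom haA hb)
  have hcase : ∀ s ∈ stageAux G (m + 2), s = a ∨ s ∈ level G (m + 2) := by
    intro s hs
    rcases mem_or_mem_level hs with h | h
    · rw [hA] at h
      exact Or.inl h
    · exact Or.inr h
  obtain ⟨p, hp, hpx⟩ := exists_dominating_of_ncard_level_eq_one' hD
  rcases hcase p hp with rfl | hpB
  · obtain ⟨b, hb⟩ := hB
    obtain ⟨c, hc, -, hcp⟩ := key b hb
    exact absurd (hpx c hc) hcp
  obtain ⟨b, hb, hbp⟩ := exists_not_reflAdj_of_dominated hdom hpB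
  obtain ⟨c, hc, hcb, hca⟩ := key b hb
  obtain ⟨s, hs, hcs, -⟩ := exists_cornering_of_mem_level hc
  have hps := hcs p (stageAux_succ_subset G _ hp) (hpx c hc).symm
  have hbs := hcs b (stageAux_succ_subset G _ hb.1) hcb.symm
  rcases hcase s hs with rfl | hsB
  · exact absurd (hcs c hc.1 (.refl G c)) hca
  obtain ⟨u, hu, hus⟩ := exists_not_reflAdj_of_dominated hdom hsB
  refine four_le_ncard hpB hb hsB hu ?_ ?_ ?_ ?_ ?_ ?_ <;> rintro rfl
  exacts [hbp (.refl G _), hbp hbs, hus hps, hbp hps.symm, hus hbs, hus (.refl G _)]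

lemma exists_pendantPair_of_dominated {a : V} (hA : stageAux G (m + 2) = {a})
    (hdom : ∀ a ∈ stageAux G (m + 2), ∀ u ∈ stageAux G (m + 1), ReflAdj G u a)
    (hB : (level G (m + 1)).ncard = 2) (hC : (level G m).ncard ≤ 2) :
    ∃ c₁ c₂ b₁ b₂, PendantPair G m c₁ c₂ b₁ b₂ ∧ b₁ ≠ b₂ := by
  obtain ⟨b₁, b₂, hne, hl⟩ := Set.ncard_eq_two.1 hB
  have h₁ : b₁ ∈ level G (m + 1) := by simp [hl]
  have h₂ : b₂ ∈ level G (m + 1) := by simp [hl]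
  have haA : a ∈ stageAux G (m + 2) := by simp [hA]
  have hb : ¬ ReflAdj G b₁ b₂ := by
    obtain ⟨b, hb, h⟩ := exists_not_reflAdj_of_dominated hdom h₂
    rw [hl] at hb
    rcases hb with rfl | rfl
    · exact h
    · exact absurd (.refl G _) h
  have hS : ∀ x ∈ stageAux G (m + 1), x = a ∨ x = b₁ ∨ x = b₂ := by
    intro x hx
    rcases mem_or_mem_level hx with h | h
    · rw [hA] at h
      exact Or.inl h
    · rw [hl] at h
      exact Or.inr h
  have hP : PendantPair G (m + 1) b₁ b₂ a a := by
    refine ⟨hl, hne, ?_, ?_, ?_, ?_⟩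
    · rintro rfl
      exact h₁.2 haA
    · rintro rfl
      exact h₂.2 haA
    · intro x hx hxb
      rcases hS x hx with rfl | rfl | rfl
      exacts [Or.inr rfl, Or.inl rfl, absurd hxb.symm hb]
    · intro x hx hxb
      rcases hS x hx with rfl | rfl | rfl
      exacts [Or.inr rfl, absurd hxb hb, Or.inl rfl]
  obtain ⟨c₁, c₂, h⟩ := hP.of_succ hC
  exact ⟨c₁, c₂, b₁, b₂, h, hne⟩

/-- Two consecutive stages below a pendant pair cannot remove at most three vertices in total. -/
lemma PendantPair.four_le {u₁ u₂ w₁ w₂ : V}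
    (h : PendantPair G (m + 2) u₁ u₂ w₁ w₂) (hw : w₁ ≠ w₂)
    (hD : (level G (m + 1)).Nonempty) (hE : (level G m).Nonempty) :
    4 ≤ (level G m).ncard + (level G (m + 1)).ncard := by
  have hD' := (Set.ncard_pos (Set.toFinite _)).2 hD
  have hE' := (Set.ncard_pos (Set.toFinite _)).2 hE
  have h1 := h.ncard_level_ne_one hw
  by_contra! hlt
  obtain ⟨d₁, d₂, hP⟩ := h.of_succ (by omega)
  have h2 := hP.ncard_level_ne_one h.ne
  omega

lemma eight_le_of_dominated {a : V} (hA : stageAux G (m + 4) = {a})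
    (hdom : ∀ a ∈ stageAux G (m + 4), ∀ u ∈ stageAux G (m + 3), ReflAdj G u a)
    (hne : ∀ j < m + 4, (level G j).Nonempty) :
    8 ≤ (level G m).ncard + (level G (m + 1)).ncard + (level G (m + 2)).ncard +
      (level G (m + 3)).ncard := by
  have hpos := fun j hj => (Set.ncard_pos (Set.toFinite _)).2 (hne j hj)
  have hE := hpos m (by omega)
  have hD := hpos (m + 1) (by omega)
  have hC := hpos (m + 2) (by omega)
  have hB : 2 ≤ (level G (m + 3)).ncard :=
    two_le_ncard_level_of_dominated hdom (hne _ (by omega))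
  have hC1 : (level G (m + 2)).ncard ≠ 1 :=
    ncard_level_ne_one_of_dominated hdom (by simp [hA]) (hne _ (by omega))
  have hD1 : (level G (m + 1)).ncard = 1 → 4 ≤ (level G (m + 3)).ncard :=
    four_le_ncard_level_of_dominated (m := m + 1) hA hdom (hne _ (by omega))
  by_contra! hlt
  obtain ⟨c₁, c₂, b₁, b₂, hP, hbb⟩ := exists_pendantPair_of_dominated (m := m + 2) hA hdom
    (show (level G (m + 3)).ncard = 2 by omega) (by omega)
  have := hP.four_le hbb (hne _ (by omega)) (hne _ (by omega))
  omega

end Dominated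

lemma exists_corners_of_undominated [Finite V]
    (hnd : ∀ a ∈ stageAux G (m + 1), ∃ u ∈ level G m, ¬ ReflAdj G u a)
    (hB : (level G m).Nonempty) :
    ∃ b₁ ∈ level G m, ∃ b₂ ∈ level G m, ∃ a₁ ∈ stageAux G (m + 1), ∃ a₂ ∈ stageAux G (m + 1),
      Corners G m b₁ a₁ ∧ Corners G m b₂ a₂ ∧ ¬ ReflAdj G b₂ a₁ ∧ b₁ ≠ b₂ ∧ a₁ ≠ a₂ := by
  obtain ⟨b₁, hb₁⟩ := hB
  obtain ⟨a₁, ha₁, h₁⟩ := exists_cornering_of_mem_level hb₁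
  obtain ⟨b₂, hb₂, hn⟩ := hnd a₁ ha₁
  obtain ⟨a₂, ha₂, h₂⟩ := exists_cornering_of_mem_level hb₂
  refine ⟨b₁, hb₁, b₂, hb₂, a₁, ha₁, a₂, ha₂, h₁, h₂, hn, ?_, ?_⟩ <;> rintro rfl
  · exact hn (h₁.1 _ hb₁.1 (.refl G _))
  · exact hn (h₂.1 _ hb₂.1 (.refl G _))

lemma ncard_level_ne_one_of_undominated [Finite V]
    (hnd : ∀ a ∈ stageAux G (m + 2), ∃ u ∈ level G (m + 1), ¬ ReflAdj G u a) :
    (level G m).ncard ≠ 1 := by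
  intro h
  obtain ⟨p, hp, hpx⟩ := exists_dominating_of_ncard_level_eq_one' h
  obtain ⟨u, hu, hup⟩ := hnd p hp
  exact hup (hpx u hu)

/-- The part of the case `|X_{α-1}| = 2` in which the dominating vertex has rank `α - 1`. -/
lemma false_of_undominated_of_pair [Finite V] {p b₂ a₁ a₂ : V}
    (hnd : ∀ a ∈ stageAux G (m + 2), ∃ u ∈ level G (m + 1), ¬ ReflAdj G u a)
    (hl : level G (m + 1) = {p, b₂}) (ha₁ : a₁ ∈ stageAux G (m + 2))
    (ha₂ : a₂ ∈ stageAux G (m + 2)) (h₁ : Corners G (m + 1) p a₁)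
    (h₂ : Corners G (m + 1) b₂ a₂) (hpx : ∀ x ∈ level G m, ReflAdj G x p) : False := by
  have hp : p ∈ level G (m + 1) := by simp [hl]
  have hb₂ : b₂ ∈ level G (m + 1) := by simp [hl]
  have hb : ¬ ReflAdj G b₂ p := by
    intro h
    have h₃ := h₁.1 b₂ hb₂.1 h
    have h₄ := h₁.1 p hp.1 (.refl G p)
    obtain ⟨u, hu, hua⟩ := hnd a₁ ha₁
    rw [hl] at hu
    rcases hu with rfl | rfl <;> contradiction
  obtain ⟨c, hc, hcb, -⟩ := exists_mem_level_not_reflAdj hb₂.1 (stageAux_succ_subset G _ ha₂) h₂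
  obtain ⟨s, hs, hcs, -⟩ := exists_cornering_of_mem_level hc
  have hps := hcs p (stageAux_succ_subset G _ hp.1) (hpx c hc).symm
  have hbs := hcs b₂ (stageAux_succ_subset G _ hb₂.1) hcb.symm
  rcases mem_or_mem_level hs with h | h
  · obtain ⟨u, hu, hus⟩ := hnd s h
    rw [hl] at hu
    rcases hu with rfl | rfl <;> contradiction
  · rw [hl] at h
    rcases h with rfl | rfl
    · exact hb hbs
    · exact hb hps.symm

/-- The part of the case `|X_{α-1}| = 2` in which the dominating vertex has rank `α`. -/
lemma not_reflAdj_of_undominated_of_pair {p b₁ b₂ a₁ a₂ : V}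
    (hclique : ∀ a ∈ stageAux G (m + 2), ∀ a' ∈ stageAux G (m + 2), ReflAdj G a a')
    (hnd : ∀ a ∈ stageAux G (m + 2), ∃ u ∈ level G (m + 1), ¬ ReflAdj G u a)
    (hl : level G (m + 1) = {b₁, b₂}) (ha₁ : a₁ ∈ stageAux G (m + 2))
    (ha₂ : a₂ ∈ stageAux G (m + 2)) (h₁ : Corners G (m + 1) b₁ a₁)
    (h₂ : Corners G (m + 1) b₂ a₂) (hpx : ∀ x ∈ level G m, ReflAdj G x p)
    (hp : p ∈ stageAux G (m + 2)) : ¬ ReflAdj G b₁ p := by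
  intro hbp
  have hb₁ : b₁ ∈ level G (m + 1) := by simp [hl]
  have hb₂ : b₂ ∈ level G (m + 1) := by simp [hl]
  have hba₁ : ¬ ReflAdj G b₂ a₁ := by
    have h₃ := h₁.1 b₁ hb₁.1 (.refl G b₁)
    obtain ⟨u, hu, hua⟩ := hnd a₁ ha₁
    rw [hl] at hu
    rcases hu with rfl | rfl
    · exact absurd h₃ hua
    · exact hua
  have hba₂ : ¬ ReflAdj G b₁ a₂ := by
    have h₃ := h₂.1 b₂ hb₂.1 (.refl G b₂)
    obtain ⟨u, hu, hua⟩ := hnd a₂ ha₂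
    rw [hl] at hu
    rcases hu with rfl | rfl
    · exact hua
    · exact absurd h₃ hua
  have hc : Corners G (m + 1) b₁ p := by
    refine ⟨fun u hu hub => ?_, a₂, stageAux_succ_subset G _ ha₂, hclique a₂ ha₂ p hp,
      fun h => hba₂ h.symm⟩
    rcases mem_or_mem_level hu with h | h
    · exact hclique u h p hp
    · rw [hl] at h
      rcases h with rfl | rfl
      · exact hbp
      · exact absurd (h₁.1 _ hu hub) hba₁
  obtain ⟨y, hy, -, hyp⟩ := exists_mem_level_not_reflAdj hb₁.1 (stageAux_succ_subset G _ hp) hc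
  exact hyp (hpx y hy)

lemma ncard_level_ne_one_of_undominated_of_pair [Finite V]
    (hclique : ∀ a ∈ stageAux G (m + 3), ∀ a' ∈ stageAux G (m + 3), ReflAdj G a a')
    (hnd : ∀ a ∈ stageAux G (m + 3), ∃ u ∈ level G (m + 2), ¬ ReflAdj G u a)
    (hB : (level G (m + 2)).ncard = 2) : (level G m).ncard ≠ 1 := by
  intro hD
  have hBne : (level G (m + 2)).Nonempty := (Set.ncard_pos (Set.toFinite _)).1 (by omega)
  obtain ⟨b₁, hb₁, b₂, hb₂, a₁, ha₁, a₂, ha₂, h₁, h₂, -, hbb, -⟩ :=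
    exists_corners_of_undominated hnd hBne
  have hl : level G (m + 2) = {b₁, b₂} := by
    refine (Set.eq_of_subset_of_ncard_le ?_ ?_ (Set.toFinite _)).symm
    · rintro x (rfl | rfl) <;> assumption
    · rw [Set.ncard_pair hbb, hB]
  have hl' : level G (m + 2) = {b₂, b₁} := by rw [hl, Set.pair_comm]
  obtain ⟨p, hp, hpx⟩ := exists_dominating_of_ncard_level_eq_one' hD
  rcases mem_or_mem_level hp with hpA | hpB
  · have n₁ := not_reflAdj_of_undominated_of_pair hclique hnd hl ha₁ ha₂ h₁ h₂ hpx hpA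
    have n₂ := not_reflAdj_of_undominated_of_pair hclique hnd hl' ha₂ ha₁ h₂ h₁ hpx hpA
    refine n₁ (reflAdj_of_closedNbhd_subset hpA (stageAux_succ_subset G _ ha₁) ?_ hb₁.1
      (h₁.1 b₁ hb₁.1 (.refl G b₁)))
    intro u hu hup
    rcases mem_or_mem_level hu with h | h
    · exact hclique u h a₁ ha₁
    · rw [hl] at h
      rcases h with rfl | rfl <;> contradiction
  · rw [hl] at hpB
    rcases hpB with rfl | rfl
    · exact false_of_undominated_of_pair hnd hl ha₁ ha₂ h₁ h₂ hpx
    · exact false_of_undominated_of_pair hnd hl' ha₂ ha₁ h₂ h₁ hpx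

lemma four_le_ncard_level_of_undominated [Finite V]
    (hnd : ∀ a ∈ stageAux G (m + 3), ∃ u ∈ level G (m + 2), ¬ ReflAdj G u a)
    (hA : (stageAux G (m + 3)).ncard = 2) (hD : (level G m).ncard = 1) :
    4 ≤ (level G (m + 2)).ncard := by
  have hother : ∀ a ∈ stageAux G (m + 3), ∃ a' ∈ stageAux G (m + 3),
      ∀ x ∈ stageAux G (m + 3), x = a ∨ x = a' := by
    intro a ha
    obtain ⟨x, y, -, hxy⟩ := Set.ncard_eq_two.1 hA
    rw [hxy] at ha ⊢
    rcases ha with rfl | rfl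
    · exact ⟨y, by simp, by simp⟩
    · exact ⟨x, by simp, by simp [or_comm]⟩
  have hcorner : ∀ a ∈ stageAux G (m + 3), ∃ b ∈ level G (m + 2), ¬ ReflAdj G b a ∧
      ∃ a' ∈ stageAux G (m + 3), (∀ x ∈ stageAux G (m + 3), x = a ∨ x = a') ∧
        Corners G (m + 2) b a' := by
    intro a ha
    obtain ⟨a', ha', hx⟩ := hother a ha
    obtain ⟨b, hb, hba⟩ := hnd a ha
    obtain ⟨z, hz, hbz⟩ := exists_cornering_of_mem_level hb
    obtain rfl | rfl := hx z hz
    · exact absurd (hbz.1 b hb.1 (.refl G b)) hba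
    · exact ⟨b, hb, hba, z, ha', hx, hbz⟩
  obtain ⟨p, hp, hpx⟩ := exists_dominating_of_ncard_level_eq_one' hD
  have hnp : ∀ b ∈ level G (m + 2), ¬ Corners G (m + 2) b p := by
    intro b hb h
    obtain ⟨y, hy, -, hyp⟩ := exists_mem_level_not_reflAdj hb.1 hp h
    exact hyp (hpx y hy)
  rcases mem_or_mem_level hp with hpA | hpB
  · exfalso
    obtain ⟨a, ha, hx⟩ := hother p hpA
    obtain ⟨b, hb, hba, a', ha', hx', hc⟩ := hcorner a ha
    obtain rfl | rfl := hx a' ha'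
    · exact hnp b hb hc
    · exact hba (hc.1 b hb.1 (.refl G b))
  obtain ⟨a₁, ha₁, h₁⟩ := exists_cornering_of_mem_level hpB
  obtain ⟨b, hb, hba, a₂, ha₂, hx, h₂⟩ := hcorner a₁ ha₁
  have hbp : ¬ ReflAdj G b p := fun h => hba (h₁.1 b hb.1 h)
  obtain ⟨c, hc, hcb, hca⟩ := exists_mem_level_not_reflAdj hb.1 (stageAux_succ_subset G _ ha₂) h₂
  obtain ⟨s, hs, hcs, -⟩ := exists_cornering_of_mem_level hc
  have hps := hcs p (stageAux_succ_subset G _ hp) (hpx c hc).symm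
  have hbs := hcs b (stageAux_succ_subset G _ hb.1) hcb.symm
  have hcs' := hcs c hc.1 (.refl G c)
  rcases mem_or_mem_level hs with hsA | hsB
  · obtain rfl | rfl := hx s hsA <;> contradiction
  obtain ⟨z, hz, hsz, -⟩ := exists_cornering_of_mem_level hsB
  have hbz := hsz b hb.1 hbs
  have hpz := hsz p hp hps
  have hsz' := hsz s hs (.refl G s)
  obtain ⟨u, hu, huz⟩ := hnd z hz
  refine four_le_ncard hpB hb hsB hu ?_ ?_ ?_ ?_ ?_ ?_ <;> rintro rfl
  exacts [hbp (.refl G _), hbp hbs, huz hpz, hbp hps.symm, huz hbz, huz hsz']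

lemma exists_pendantPair_of_undominated [Finite V]
    (hnd : ∀ a ∈ stageAux G (m + 1), ∃ u ∈ level G m, ¬ ReflAdj G u a)
    (hA : (stageAux G (m + 1)).ncard = 2) (hB : (level G m).ncard = 2) :
    ∃ b₁ b₂ a₁ a₂, PendantPair G m b₁ b₂ a₁ a₂ ∧ a₁ ≠ a₂ := by
  have hBne : (level G m).Nonempty := (Set.ncard_pos (Set.toFinite _)).1 (by omega)
  obtain ⟨b₁, hb₁, b₂, hb₂, a₁, ha₁, a₂, ha₂, h₁, h₂, hba₁, hbb, haa⟩ :=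
    exists_corners_of_undominated hnd hBne
  have hl : level G m = {b₁, b₂} := by
    refine (Set.eq_of_subset_of_ncard_le ?_ ?_ (Set.toFinite _)).symm
    · rintro x (rfl | rfl) <;> assumption
    · rw [Set.ncard_pair hbb, hB]
  have hA' : stageAux G (m + 1) = {a₁, a₂} := by
    refine (Set.eq_of_subset_of_ncard_le ?_ ?_ (Set.toFinite _)).symm
    · rintro x (rfl | rfl) <;> assumption
    · rw [Set.ncard_pair haa, hA]
  have hba₂ : ¬ ReflAdj G b₁ a₂ := by
    have h₃ := h₂.1 b₂ hb₂.1 (.refl G b₂)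
    obtain ⟨u, hu, hua⟩ := hnd a₂ ha₂
    rw [hl] at hu
    rcases hu with rfl | rfl
    · exact hua
    · exact absurd h₃ hua
  have hS : ∀ x ∈ stageAux G m, (x = a₁ ∨ x = a₂) ∨ x = b₁ ∨ x = b₂ := by
    intro x hx
    have := mem_or_mem_level hx
    rwa [hA', hl] at this
  refine ⟨b₁, b₂, a₁, a₂, ⟨hl, hbb, ?_, ?_, ?_, ?_⟩, haa⟩
  · rintro rfl
    exact hb₁.2 ha₂
  · rintro rfl
    exact hb₂.2 ha₁
  · intro x hx hxb
    rcases hS x hx with (rfl | rfl) | rfl | rfl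
    exacts [Or.inr rfl, absurd hxb.symm hba₂, Or.inl rfl, absurd (h₁.1 _ hx hxb) hba₁]
  · intro x hx hxb
    rcases hS x hx with (rfl | rfl) | rfl | rfl
    exacts [absurd hxb.symm hba₁, Or.inr rfl, absurd (h₂.1 _ hx hxb) hba₂, Or.inl rfl]

lemma ten_le_of_undominated [Finite V]
    (hclique : ∀ a ∈ stageAux G (m + 4), ∀ a' ∈ stageAux G (m + 4), ReflAdj G a a')
    (hnd : ∀ a ∈ stageAux G (m + 4), ∃ u ∈ level G (m + 3), ¬ ReflAdj G u a)
    (hne : ∀ j < m + 4, (level G j).Nonempty) :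
    10 ≤ (level G m).ncard + (level G (m + 1)).ncard + (level G (m + 2)).ncard +
      (level G (m + 3)).ncard + (stageAux G (m + 4)).ncard := by
  have hpos := fun j hj => (Set.ncard_pos (Set.toFinite _)).2 (hne j hj)
  have hE := hpos m (by omega)
  have hD := hpos (m + 1) (by omega)
  have hC := hpos (m + 2) (by omega)
  obtain ⟨b₁, hb₁, b₂, hb₂, a₁, ha₁, a₂, ha₂, -, -, -, hbb, haa⟩ :=
    exists_corners_of_undominated hnd (hne _ (by omega))
  have hA : 2 ≤ (stageAux G (m + 4)).ncard := two_le_ncard ha₁ ha₂ haa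
  have hB : 2 ≤ (level G (m + 3)).ncard := two_le_ncard hb₁ hb₂ hbb
  have hC1 : (level G (m + 2)).ncard ≠ 1 := ncard_level_ne_one_of_undominated hnd
  have hD1 : (level G (m + 3)).ncard = 2 → (level G (m + 1)).ncard ≠ 1 :=
    ncard_level_ne_one_of_undominated_of_pair hclique hnd
  have hD2 : (stageAux G (m + 4)).ncard = 2 → (level G (m + 1)).ncard = 1 →
    4 ≤ (level G (m + 3)).ncard := four_le_ncard_level_of_undominated hnd
  by_contra! hlt
  obtain ⟨b₁, b₂, a₁, a₂, hP, haa⟩ := exists_pendantPair_of_undominated hnd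
    (show (stageAux G (m + 4)).ncard = 2 by omega) (show (level G (m + 3)).ncard = 2 by omega)
  obtain ⟨c₁, c₂, hP'⟩ := PendantPair.of_succ (k := m + 2) hP (by omega)
  have := hP'.four_le hP.ne (hne _ (by omega)) (hne _ (by omega))
  omega

lemma exists_of_cornerRank_ne_top {v : V} (h : cornerRank G v ≠ ⊤) :
    ∃ k, StrictCorner G (stageAux G k) v ∨ (G.IsClique (stageAux G k) ∧ v ∈ stageAux G k) := by
  by_contra! hc
  refine h (sInf_eq_top.2 ?_)
  rintro _ ⟨n, -, -, hn | hn⟩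
  · exact absurd hn (hc _).1
  · exact absurd hn.2 ((hc _).2 hn.1)

lemma exists_isClique_stageAux [Finite V] (hG : CopWin G) :
    ∃ k, G.IsClique (stageAux G k) := by
  by_contra! hc
  have h : ∀ v, ∃ k, v ∉ stageAux G (k + 1) := by
    intro v
    obtain ⟨k, hk | hk⟩ := exists_of_cornerRank_ne_top (hG v)
    · exact ⟨k, notMem_stageAux_succ_of_strictCorner hk⟩
    · exact absurd hk.1 (hc k)
  choose f hf using h
  obtain ⟨k, hk⟩ := (Set.finite_range f).bddAbove
  refine hc (k + 1) fun v hv => absurd ?_ (hf v)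
  exact stageAux_antitone G (Nat.succ_le_succ (hk ⟨v, rfl⟩)) hv

lemma stageAux_nonempty [Finite V] [Nonempty V] (G : SimpleGraph V) (k : ℕ) :
    (stageAux G k).Nonempty := by
  induction k with
  | zero => exact Set.univ_nonempty
  | succ k ih =>
    obtain ⟨w, hw, hmax⟩ := Set.Finite.exists_maximalFor (closedNbhd G (stageAux G k))
      (stageAux G k) (Set.toFinite _) ih
    refine ⟨w, hw, ?_⟩
    rintro ⟨-, x, hx, -, hlt⟩
    exact hlt.2 (hmax hx hlt.1)

lemma stageAux_eq_of_level_eq_empty {j k : ℕ} (h : level G j = ∅) (hjk : j ≤ k) :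
    stageAux G k = stageAux G j := by
  have h1 : stageAux G (j + 1) = stageAux G j :=
    (stageAux_succ_subset G j).antisymm (Set.sdiff_eq_empty.1 h)
  induction k, hjk using Nat.le_induction with
  | base => rfl
  | succ k _ ih =>
    conv_lhs => rw [stageAux, ih]
    exact h1

lemma level_nonempty (hM : G.IsClique (stageAux G M))
    (hmin : ∀ j < M, ¬ G.IsClique (stageAux G j)) {j : ℕ} (hj : j < M) :
    (level G j).Nonempty := by
  rw [Set.nonempty_iff_ne_empty]
  intro h
  rw [stageAux_eq_of_level_eq_empty h hj.le] at hM
  exact hmin j hj hM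

lemma mem_stageAux_or_exists_mem_level (v : V) (k : ℕ) :
    v ∈ stageAux G k ∨ ∃ j < k, v ∈ level G j := by
  induction k with
  | zero => exact Or.inl trivial
  | succ k ih =>
    rcases ih with h | ⟨j, hj, h⟩
    · exact (mem_or_mem_level h).imp_right fun h => ⟨k, k.lt_succ_self, h⟩
    · exact Or.inr ⟨j, hj.trans k.lt_succ_self, h⟩

lemma le_cornerRank {v : V} {j : ℕ} (hv : v ∈ stageAux G j)
    (hmin : ∀ i < j, ¬ G.IsClique (stageAux G i)) : ((j + 1 : ℕ) : ℕ∞) ≤ cornerRank G v := by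
  refine le_sInf ?_
  rintro _ ⟨n, rfl, hn, h⟩
  rw [Nat.cast_le]
  by_contra! hlt
  rcases h with h | h
  · exact notMem_stageAux_succ_of_strictCorner h (stageAux_antitone G (by omega) hv)
  · exact hmin (n - 1) (by omega) h.1

lemma cornerRank_of_mem_level (hmin : ∀ j < M, ¬ G.IsClique (stageAux G j)) {v : V} {j : ℕ}
    (hj : j < M) (hv : v ∈ level G j) : cornerRank G v = ((j + 1 : ℕ) : ℕ∞) :=
  le_antisymm (sInf_le ⟨j + 1, rfl, by omega, Or.inl (strictCorner_of_mem_level hv)⟩)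
    (le_cornerRank hv.1 fun i hi => hmin i (hi.trans hj))

lemma cornerRank_of_mem_stageAux (hM : G.IsClique (stageAux G M))
    (hmin : ∀ j < M, ¬ G.IsClique (stageAux G j)) {v : V} (hv : v ∈ stageAux G M) :
    cornerRank G v = ((M + 1 : ℕ) : ℕ∞) :=
  le_antisymm (sInf_le ⟨M + 1, rfl, by omega, Or.inr ⟨hM, hv⟩⟩) (le_cornerRank hv hmin)

lemma setOf_cornerRank_eq_level (hM : G.IsClique (stageAux G M))
    (hmin : ∀ j < M, ¬ G.IsClique (stageAux G j)) {j : ℕ} (hj : j < M) :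
    {v | cornerRank G v = ((j + 1 : ℕ) : ℕ∞)} = level G j := by
  ext v
  refine ⟨fun h => ?_, cornerRank_of_mem_level hmin hj⟩
  rw [Set.mem_ofPred_eq] at h
  rcases mem_stageAux_or_exists_mem_level (G := G) v M with hv | ⟨i, hi, hv⟩
  · rw [cornerRank_of_mem_stageAux hM hmin hv, Nat.cast_inj] at h
    omega
  · rw [cornerRank_of_mem_level hmin hi hv, Nat.cast_inj] at h
    obtain rfl : i = j := by omega
    exact hv

lemma setOf_cornerRank_eq_stageAux (hM : G.IsClique (stageAux G M))
    (hmin : ∀ j < M, ¬ G.IsClique (stageAux G j)) :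
    {v | cornerRank G v = ((M + 1 : ℕ) : ℕ∞)} = stageAux G M := by
  ext v
  refine ⟨fun h => ?_, cornerRank_of_mem_stageAux hM hmin⟩
  rw [Set.mem_ofPred_eq] at h
  rcases mem_stageAux_or_exists_mem_level (G := G) v M with hv | ⟨i, hi, hv⟩
  · exact hv
  · rw [cornerRank_of_mem_level hmin hi hv, Nat.cast_inj] at h
    omega

lemma graphRank_eq [Finite V] [Nonempty V] (hM : G.IsClique (stageAux G M))
    (hmin : ∀ j < M, ¬ G.IsClique (stageAux G j)) : graphRank G = ((M + 1 : ℕ) : ℕ∞) := by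
  refine le_antisymm (iSup_le fun v => ?_) ?_
  · rcases mem_stageAux_or_exists_mem_level (G := G) v M with hv | ⟨i, hi, hv⟩
    · exact (cornerRank_of_mem_stageAux hM hmin hv).le
    · rw [cornerRank_of_mem_level hmin hi hv, Nat.cast_le]
      omega
  · obtain ⟨v, hv⟩ := stageAux_nonempty G M
    exact (cornerRank_of_mem_stageAux hM hmin hv).symm.le.trans (le_iSup (cornerRank G) v)

lemma sum_ncard_level_add_ncard_stageAux [Finite V] (G : SimpleGraph V) (k : ℕ) :
    ∑ j ∈ Finset.range k, (level G j).ncard + (stageAux G k).ncard = Nat.card V := by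
  induction k with
  | zero => simp [stageAux, Set.ncard_univ]
  | succ k ih =>
    rw [← ih, Finset.sum_range_succ, add_assoc, level,
      Set.ncard_sdiff_add_ncard_of_subset (stageAux_succ_subset G k) (Set.toFinite _)]

lemma tp1_iff [Finite V] [Nonempty V] {m : ℕ} (hM : G.IsClique (stageAux G (m + 1)))
    (hmin : ∀ j < m + 1, ¬ G.IsClique (stageAux G j)) :
    Tp1 G ↔ ∃ a ∈ stageAux G (m + 1), ∀ u ∈ stageAux G m, ReflAdj G u a := by
  have hr := graphRank_eq hM hmin
  have hset := setOf_cornerRank_eq_stageAux hM hmin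
  constructor
  · rintro ⟨α, -, hα, v, hv, hdom⟩
    rw [hr, Nat.cast_inj] at hα
    subst hα
    exact ⟨v, hset ▸ hv, fun u hu => (hdom u hu).imp_right SimpleGraph.Adj.symm⟩
  · rintro ⟨a, ha, h⟩
    refine ⟨m + 2, by omega, hr, a, ?_, fun u hu => (h u hu).imp_right SimpleGraph.Adj.symm⟩
    rwa [← hset] at ha

lemma reflAdj_of_isClique {S : Set V} (hS : G.IsClique S) :
    ∀ a ∈ S, ∀ a' ∈ S, ReflAdj G a a' := fun _ ha _ ha' =>
  or_iff_not_imp_left.2 (hS ha ha')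

lemma reflAdj_of_tp1 [Finite V] [Nonempty V] {m : ℕ} (hM : G.IsClique (stageAux G (m + 1)))
    (hmin : ∀ j < m + 1, ¬ G.IsClique (stageAux G j)) (h : Tp1 G) :
    ∀ a ∈ stageAux G (m + 1), ∀ u ∈ stageAux G m, ReflAdj G u a := by
  obtain ⟨a₀, ha₀, h₀⟩ := (tp1_iff hM hmin).1 h
  intro a ha u hu
  exact reflAdj_of_closedNbhd_subset ha (stageAux_succ_subset G _ ha₀) (fun x hx _ => h₀ x hx) hu
    (h₀ u hu)

lemma exists_not_reflAdj_of_not_tp1 [Finite V] [Nonempty V] {m : ℕ}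
    (hM : G.IsClique (stageAux G (m + 1)))
    (hmin : ∀ j < m + 1, ¬ G.IsClique (stageAux G j)) (h : ¬ Tp1 G) :
    ∀ a ∈ stageAux G (m + 1), ∃ u ∈ level G m, ¬ ReflAdj G u a := by
  rw [tp1_iff hM hmin] at h
  push Not at h
  intro a ha
  obtain ⟨u, hu, hua⟩ := h a ha
  exact ⟨u, ⟨hu, fun hu' => hua (reflAdj_of_isClique hM u hu' a ha)⟩, hua⟩

lemma le_sum_range_of_pos {f : ℕ → ℕ} {k : ℕ} (hf : ∀ j < k, 0 < f j) :
    k ≤ ∑ j ∈ Finset.range k, f j := by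
  simpa using Finset.card_nsmul_le_sum (Finset.range k) f 1 fun j hj => hf j (Finset.mem_range.1 hj)

lemma eq_one_of_sum_range_le {f : ℕ → ℕ} {k : ℕ} (hf : ∀ j < k, 0 < f j)
    (hsum : ∑ j ∈ Finset.range k, f j ≤ k) : ∀ j < k, f j = 1 := by
  have h : ∑ j ∈ Finset.range k, 1 = ∑ j ∈ Finset.range k, f j := by
    have := le_sum_range_of_pos hf
    simp
    omega
  rw [Finset.sum_eq_sum_iff_of_le fun j hj => hf j (Finset.mem_range.1 hj)] at h
  exact fun j hj => (h j (Finset.mem_range.2 hj)).symm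

/-- The number of vertices of a tp0 cop-win graph of corner rank `M + 1 ≥ 5`. -/
lemma add_six_le_card_of_not_tp1 [Finite V] [Nonempty V] (hM : G.IsClique (stageAux G M))
    (hmin : ∀ j < M, ¬ G.IsClique (stageAux G j)) (h : ¬ Tp1 G) (h4 : 4 ≤ M) :
    M + 6 ≤ Nat.card V := by
  obtain ⟨m, rfl⟩ := Nat.exists_eq_add_of_le' h4
  have hne := fun j hj => level_nonempty hM hmin (j := j) hj
  have h10 := ten_le_of_undominated (reflAdj_of_isClique hM)
    (exists_not_reflAdj_of_not_tp1 hM hmin h) hne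
  have hsum := sum_ncard_level_add_ncard_stageAux G (m + 4)
  simp only [Finset.sum_range_succ] at hsum
  have hlow := le_sum_range_of_pos (f := fun j => (level G j).ncard) (k := m)
    fun j hj => (Set.ncard_pos (Set.toFinite _)).2 (hne j (by omega))
  omega

/-- The rank cardinalities of a tp1 cop-win graph of corner rank `M + 1 ≥ 5` on `M + 4`
vertices. -/
lemma ncard_of_tp1 [Finite V] [Nonempty V] {m : ℕ} (hM : G.IsClique (stageAux G (m + 4)))
    (hmin : ∀ j < m + 4, ¬ G.IsClique (stageAux G j)) (h : Tp1 G) (hcard : Nat.card V = m + 8) :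
    (stageAux G (m + 4)).ncard = 2 ∧ (level G (m + 3)).ncard = 2 ∧
      (level G (m + 2)).ncard = 2 ∧ ∀ j < m + 2, (level G j).ncard = 1 := by
  have hne := fun j hj => level_nonempty hM hmin (j := j) hj
  have hpos := fun j hj => (Set.ncard_pos (Set.toFinite _)).2 (hne j hj)
  have hdom := reflAdj_of_tp1 hM hmin h
  have hA := (Set.ncard_pos (Set.toFinite _)).2 (stageAux_nonempty G (m + 4))
  have hB : 2 ≤ (level G (m + 3)).ncard :=
    two_le_ncard_level_of_dominated hdom (hne _ (by omega))
  have hC := hpos (m + 2) (by omega)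
  have hC1 : (level G (m + 2)).ncard ≠ 1 :=
    ncard_level_ne_one_of_dominated hdom (stageAux_nonempty G _) (hne _ (by omega))
  have hsum := sum_ncard_level_add_ncard_stageAux G (m + 4)
  have hlow := le_sum_range_of_pos (f := fun j => (level G j).ncard) (k := m)
    fun j hj => hpos j (by omega)
  have hlow' := le_sum_range_of_pos (f := fun j => (level G j).ncard) (k := m + 2)
    fun j hj => hpos j (by omega)
  have hA1 : (stageAux G (m + 4)).ncard ≠ 1 := by
    intro h1
    obtain ⟨a, ha⟩ := Set.ncard_eq_one.1 h1
    have h8 := eight_le_of_dominated ha hdom hne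
    simp only [Finset.sum_range_succ] at hsum
    omega
  rw [Finset.sum_range_succ, Finset.sum_range_succ] at hsum
  refine ⟨by omega, by omega, by omega, ?_⟩
  exact eq_one_of_sum_range_le (fun j hj => hpos j (by omega)) (by omega)

lemma realizes_of_ncard [Finite V] [Nonempty V] {m : ℕ} (hG : CopWin G)
    (hM : G.IsClique (stageAux G (m + 4))) (hmin : ∀ j < m + 4, ¬ G.IsClique (stageAux G j))
    (hA : (stageAux G (m + 4)).ncard = 2) (hB : (level G (m + 3)).ncard = 2)
    (hC : (level G (m + 2)).ncard = 2) (hone : ∀ j < m + 2, (level G j).ncard = 1) :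
    Realizes G (2 :: 2 :: 2 :: List.replicate (m + 2) 1) := by
  have hlev := fun j hj => setOf_cornerRank_eq_level hM hmin (j := j) hj
  have hlen : (2 :: 2 :: 2 :: List.replicate (m + 2) 1).length = m + 5 := by simp
  refine ⟨hG, ?_, ?_⟩
  · rw [hlen]
    exact graphRank_eq hM hmin
  rintro ⟨i, hi⟩
  have key : ∀ j, j + i + 1 = m + 5 →
      {v | cornerRank G v = (((2 :: 2 :: 2 :: List.replicate (m + 2) 1).length - i : ℕ) : ℕ∞)} =
        {v | cornerRank G v = ((j + 1 : ℕ) : ℕ∞)} := by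
    intro j hj
    rw [hlen, show m + 5 - i = j + 1 by omega]
  rcases i with _ | _ | _ | i
  · rw [key (m + 4) (by omega), setOf_cornerRank_eq_stageAux hM hmin, hA]
    rfl
  · rw [key (m + 3) (by omega), hlev (m + 3) (by omega), hB]
    rfl
  · rw [key (m + 2) (by omega), hlev (m + 2) (by omega), hC]
    rfl
  · have hi' : i < m + 2 := by
      rw [hlen] at hi
      omega
    rw [key (m + 1 - i) (by omega), hlev _ (by omega), hone _ (by omega)]
    simp

end CopsRobbers

/-- for `n ≥ 9`, a cop-win graph on `n` vertices is CT-maximal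
(capture time `n - 4`) iff its rank cardinality vector is `(2,2,2,1,…,1)` of length
`n - 3`; moreover any such graph is tp1. -/
theorem CopsRobbers.CTmaximal_characterization
    (n : ℕ) (hn : 9 ≤ n) {V : Type} [Fintype V] (G : SimpleGraph V)
    (hcard : Fintype.card V = n) (hG : CopsRobbers.CopWin G) :
    (CopsRobbers.captureTime G = n - 4 ↔
      CopsRobbers.Realizes G (2 :: 2 :: 2 :: List.replicate (n - 6) 1)) ∧
    (CopsRobbers.captureTime G = n - 4 → CopsRobbers.Tp1 G) := by
  have hcard' : Nat.card V = n := by rw [Nat.card_eq_fintype_card, hcard]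
  have : Nonempty V := Fintype.card_pos_iff.1 (by omega)
  obtain ⟨M, hM, hmin⟩ : ∃ M, G.IsClique (stageAux G M) ∧ ∀ j < M, ¬ G.IsClique (stageAux G j) := by
    classical
    have h := exists_isClique_stageAux hG
    exact ⟨Nat.find h, Nat.find_spec h, fun j hj => Nat.find_min h hj⟩
  have hr := graphRank_eq hM hmin
  have htp : 4 ≤ M → n < M + 6 → Tp1 G := fun h4 hlt => by
    by_contra h
    have := add_six_le_card_of_not_tp1 hM hmin h h4
    omega
  classical
  have hct : captureTime G = M + 1 - if Tp1 G then 1 else 0 := by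
    simp only [captureTime, hr, ENat.toNat_natCast]
  have hforward : captureTime G = n - 4 → Tp1 G := by
    intro h
    rw [hct] at h
    exact htp (by split_ifs at h <;> omega) (by split_ifs at h <;> omega)
  refine ⟨⟨fun h => ?_, fun h => ?_⟩, hforward⟩
  · have ht := hforward h
    rw [hct, if_pos ht] at h
    obtain ⟨m, rfl⟩ : ∃ m, M = m + 4 := ⟨M - 4, by omega⟩
    obtain ⟨hA, hB, hC, hone⟩ := ncard_of_tp1 hM hmin ht (by omega)
    obtain rfl : n = m + 8 := by omega
    exact realizes_of_ncard hG hM hmin hA hB hC hone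
  · have hlen := h.2.1
    rw [hr, Nat.cast_inj] at hlen
    simp only [List.length_cons, List.length_replicate] at hlen
    rw [hct, if_pos (htp (by omega) (by omega))]
    omega
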